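/- Leading term of F and coincidence of the two transition terms: as Δr → 0⁺, for every ω ∈ {0,1,2} and u = u₀u₁…u_{k−1} ∈ {0,1,2}^k one has F_0(ω,u) = Ĉ(ρ₀(r)) · ( −[ X_{1,0}·(1−ω) + X_{0,1}·(1−u₀) ] )^m · (Δr/2)^m + O(Δr^{m+1}), where X_{1,0} := (v/D)·ρ₀(r) and X_{0,1} := −(v/D)·ρ₀(r) + ρ₀'(r); moreover F_{1−ω}(ω,u) has the identical leading term, i.e. F_0(ω,u) − F_{1−ω}(ω,u) = O(Δr^{m+1}). Consequently the leading-order term of 𝓕 := F_0(ω,u) + ε·(−1)^m·F_{1−ω}(ω,u) carries the coefficient (1 + ε·(−1)^m). -/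

import Mathlib

open Filter Finset

noncomputable section

/-- Transition probability η on trits: η(0) = (β/2)(1 − Pe/2), η(1) = 1 − β,
η(2) = (β/2)(1 + Pe/2). -/
def eta (β Pe : ℝ) (ω : Fin 3) : ℝ :=
  if (ω : ℕ) = 0 then β / 2 * (1 - Pe / 2)
  else if (ω : ℕ) = 1 then 1 - β
  else β / 2 * (1 + Pe / 2)

/-- ν(ω) = η(2 − ω). -/
def nu (β Pe : ℝ) (ω : Fin 3) : ℝ :=
  if (ω : ℕ) = 0 then β / 2 * (1 + Pe / 2)
  else if (ω : ℕ) = 1 then 1 - β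
  else β / 2 * (1 - Pe / 2)

/-- Bulk local density ρ̂ⱼ(u′) = (∏ η(u_d)/ν(u_d)) · ρ₀(r + (j + Σ (1 − u_d))·Δr). -/
def rhoHat (β Pe r Δr : ℝ) (ρ₀ : ℝ → ℝ) {K : ℕ} (j : ℤ) (u : Fin K → Fin 3) : ℝ :=
  (∏ d, eta β Pe (u d) / nu β Pe (u d)) *
    ρ₀ (r + ((j : ℝ) + ∑ d, (1 - ((u d : ℕ) : ℝ))) * Δr)

/-- F_j(ω, u) with u = u₀u′ :
F_j(ω,u) = f((η(ω)/ν(ω))·ρ̂_j(u′), (η(u₀)/ν(u₀))·ρ̂_{j+1−u₀}(u′)). -/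
def Floc (β Pe r Δr : ℝ) (ρ₀ : ℝ → ℝ) (f : ℝ → ℝ → ℝ) {K : ℕ}
    (j : ℤ) (ω u₀ : Fin 3) (u' : Fin K → Fin 3) : ℝ :=
  f (eta β Pe ω / nu β Pe ω * rhoHat β Pe r Δr ρ₀ j u')
    (eta β Pe u₀ / nu β Pe u₀ * rhoHat β Pe r Δr ρ₀ (j + 1 - ((u₀ : ℕ) : ℤ)) u')

/-- K(Δr): the sum over the trit ω and the k-digit trit string u = u₀u′. -/
def Ksum (D v β r : ℝ) (k : ℕ) (ρ₀ : ℝ → ℝ) (f : ℝ → ℝ → ℝ)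
    (ε δ : ℝ) (m : ℕ) (Δr : ℝ) : ℝ :=
  Δr * ∑ ω : Fin 3, ∑ u₀ : Fin 3, ∑ u' : Fin (k - 1) → Fin 3,
    (eta β (v * Δr / D) ω + δ * nu β (v * Δr / D) ω) *
      (nu β (v * Δr / D) u₀ * ∏ d, nu β (v * Δr / D) (u' d)) *
      (Floc β (v * Δr / D) r Δr ρ₀ f 0 ω u₀ u' +
        ε * (-1 : ℝ) ^ m * Floc β (v * Δr / D) r Δr ρ₀ f (1 - ((ω : ℕ) : ℤ)) ω u₀ u')

/-- The spatio-temporally averaged T¹-type quantity ⟨A⟩(Δr) = K/(τ·Δr),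
with τ = β·Δr²/(2D). -/
def avgA (D v β r : ℝ) (k : ℕ) (ρ₀ : ℝ → ℝ) (f : ℝ → ℝ → ℝ)
    (ε δ : ℝ) (m : ℕ) (Δr : ℝ) : ℝ :=
  Ksum D v β r k ρ₀ f ε δ m Δr / (β * Δr ^ 2 / (2 * D) * Δr)

/-- f̃(X,Y) = f(Y + X, Y − X). -/
def ftilde (f : ℝ → ℝ → ℝ) (X Y : ℝ) : ℝ := f (Y + X) (Y - X)

open Asymptotics Topology

/-- The iterated partial derivatives in the first variable of a jointly smooth function are
jointly smooth. -/
theorem contDiff_iteratedDeriv_fst {g : ℝ × ℝ → ℝ} (hg : ContDiff ℝ (⊤ : ℕ∞) g) (n : ℕ) :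
    ContDiff ℝ (⊤ : ℕ∞) (fun p : ℝ × ℝ => iteratedDeriv n (fun X => g (X, p.2)) p.1) := by
  induction n with
  | zero => simpa using hg
  | succ n ih =>
    set G : ℝ × ℝ → ℝ := fun p => iteratedDeriv n (fun X => g (X, p.2)) p.1 with hG
    have key : (fun p : ℝ × ℝ => iteratedDeriv (n + 1) (fun X => g (X, p.2)) p.1) =
        fun p => fderiv ℝ G p (1, 0) := by
      funext p
      rw [iteratedDeriv_succ]
      have hline : HasDerivAt (fun X : ℝ => (X, p.2)) ((1 : ℝ), (0 : ℝ)) p.1 :=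
        (hasDerivAt_id p.1).prodMk (hasDerivAt_const p.1 p.2)
      have hGp : HasFDerivAt G (fderiv ℝ G p) (p.1, p.2) :=
        (ih.differentiable (by simp) p).hasFDerivAt
      exact (hGp.comp_hasDerivAt p.1 hline).deriv
    rw [key]
    exact (ih.fderiv_right (by simp)).clm_apply contDiff_const

/-- Taylor expansion in the first variable, uniform in the second one, of a smooth function whose
first `m` partial derivatives in the first variable vanish on the axis. -/
theorem isBigO_sub_leading_of_iteratedDeriv_eq_zero {g : ℝ × ℝ → ℝ}
    (hg : ContDiff ℝ (⊤ : ℕ∞) g) {m : ℕ} {c : ℝ → ℝ}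
    (hlow : ∀ Y : ℝ, ∀ j < m, iteratedDeriv j (fun X => g (X, Y)) 0 = 0)
    (hchar : ∀ Y : ℝ, iteratedDeriv m (fun X => g (X, Y)) 0 = (m.factorial : ℝ) * c Y)
    (Y₀ : ℝ) :
    (fun p : ℝ × ℝ => g p - c p.2 * p.1 ^ m) =O[𝓝 (0, Y₀)] (fun p => p.1 ^ (m + 1)) := by
  set H : ℝ × ℝ → ℝ := fun p => iteratedDeriv (m + 1) (fun X => g (X, p.2)) p.1 with hH
  have hHc : Continuous H := (contDiff_iteratedDeriv_fst hg (m + 1)).continuous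
  have hbd : ∀ᶠ p in 𝓝 ((0 : ℝ), Y₀), |H p| < |H (0, Y₀)| + 1 :=
    hHc.abs.continuousAt.eventually_lt continuousAt_const (by simp)
  obtain ⟨a, ha, hball⟩ := Metric.eventually_nhds_iff.1 hbd
  refine IsBigO.of_bound (|H (0, Y₀)| + 1) ?_
  filter_upwards [Metric.ball_mem_nhds ((0 : ℝ), Y₀) ha] with p hp
  obtain ⟨X, Y⟩ := p
  have hsm : ContDiff ℝ (⊤ : ℕ∞) (fun X => g (X, Y)) :=
    hg.comp (contDiff_id.prodMk contDiff_const)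
  have htaylor : ∀ s : Set ℝ, UniqueDiffOn ℝ s → (0 : ℝ) ∈ s →
      taylorWithinEval (fun X => g (X, Y)) m s 0 X = c Y * X ^ m := by
    intro s hs h0
    have hd : ∀ n, iteratedDerivWithin n (fun X => g (X, Y)) s 0 =
        iteratedDeriv n (fun X => g (X, Y)) 0 := fun n =>
      iteratedDerivWithin_eq_iteratedDeriv hs
        (hsm.contDiffAt.of_le (mod_cast le_top)) h0
    rw [taylor_within_apply, Finset.sum_range_succ, Finset.sum_eq_zero]
    · have := m.factorial_ne_zero
      rw [hd, hchar]
      simp only [sub_zero, smul_eq_mul, zero_add]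
      field_simp
    · intro j hj
      rw [hd, hlow Y j (Finset.mem_range.1 hj), smul_zero]
  rcases eq_or_ne 0 X with rfl | hX
  · have := htaylor Set.univ uniqueDiffOn_univ (Set.mem_univ _)
    rw [taylorWithinEval_self] at this
    simp [this]
  obtain ⟨ξ, hξ, heq⟩ := taylor_mean_remainder_lagrange_iteratedDeriv (n := m) hX
    (hsm.of_le (mod_cast le_top)).contDiffOn
  rw [htaylor _ (uniqueDiffOn_uIcc hX) Set.left_mem_uIcc] at heq
  have hξX : |ξ| ≤ |X| := by
    have := Set.abs_sub_left_of_mem_uIcc (Set.uIoo_subset_uIcc_self hξ)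
    simpa using this
  have hξball : |H (ξ, Y)| < |H (0, Y₀)| + 1 := by
    apply hball
    rw [Metric.mem_ball, Prod.dist_eq, max_lt_iff] at hp
    rw [Prod.dist_eq, max_lt_iff]
    refine ⟨lt_of_le_of_lt ?_ hp.1, hp.2⟩
    simpa [Real.dist_eq] using hξX
  have hfac : (1 : ℝ) ≤ ((m + 1).factorial : ℝ) := by
    exact_mod_cast Nat.succ_le_of_lt (Nat.factorial_pos _)
  simp only [heq, sub_zero, Real.norm_eq_abs, abs_div, abs_mul, Nat.abs_cast]
  calc |iteratedDeriv (m + 1) (fun X => g (X, Y)) ξ| * |X ^ (m + 1)| / ((m + 1).factorial : ℝ)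
      ≤ |iteratedDeriv (m + 1) (fun X => g (X, Y)) ξ| * |X ^ (m + 1)| :=
        div_le_self (by positivity) hfac
    _ ≤ (|H (0, Y₀)| + 1) * |X ^ (m + 1)| :=
        mul_le_mul_of_nonneg_right hξball.le (abs_nonneg _)

/-- First order Taylor expansion with quadratic remainder at the origin. -/
theorem isBigO_sub_sub_mul_deriv {h : ℝ → ℝ} (hh : ContDiffAt ℝ 2 h 0) :
    (fun t => h t - h 0 - t * deriv h 0) =O[𝓝 0] (fun t => t ^ 2) := by
  have hd : DifferentiableAt ℝ (deriv h) 0 := by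
    have hfd := (hh.fderiv_right (m := 1) (by norm_num)).differentiableAt one_ne_zero
    exact hfd.clm_apply (differentiableAt_const (1 : ℝ))
  obtain ⟨C, hC, hbd⟩ := hd.isBigO_sub.exists_pos
  have hdiff : ∀ᶠ t in 𝓝 (0 : ℝ), DifferentiableAt ℝ h t :=
    (hh.eventually (by simp)).mono fun t ht => ht.differentiableAt two_ne_zero
  obtain ⟨a, ha, hball⟩ := Metric.eventually_nhds_iff.1 (hbd.bound.and hdiff)
  refine IsBigO.of_bound C ?_
  filter_upwards [Metric.ball_mem_nhds (0 : ℝ) ha] with t ht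
  have hmem : ∀ x ∈ Metric.closedBall (0 : ℝ) |t|, |x| ≤ |t| ∧ dist x 0 < a := fun x hx => by
    have hxt : |x| ≤ |t| := by simpa using hx
    exact ⟨hxt, lt_of_le_of_lt (by simpa using hxt) ht⟩
  have hmv := (convex_closedBall (0 : ℝ) |t|).norm_image_sub_le_of_norm_hasDerivWithin_le
    (f := fun x => h x - x * deriv h 0) (f' := fun x => deriv h x - deriv h 0) (C := C * |t|)
    (x := 0) (y := t)
    (fun x hx => by
      have := (hball (hmem x hx).2).2.hasDerivAt.sub ((hasDerivAt_id x).mul_const (deriv h 0))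
      rw [one_mul] at this
      exact this.hasDerivWithinAt)
    (fun x hx => (hball (hmem x hx).2).1.trans (by
      have := (hmem x hx).1
      rw [sub_zero, Real.norm_eq_abs]
      gcongr))
    (by simp) (by simp)
  calc ‖h t - h 0 - t * deriv h 0‖ = ‖h t - t * deriv h 0 - (h 0 - 0 * deriv h 0)‖ := by
        congr 1
        ring
    _ ≤ C * |t| * ‖t - 0‖ := hmv
    _ = C * ‖t ^ 2‖ := by
        rw [sub_zero, norm_pow, Real.norm_eq_abs]
        ring

/-- Composition of the leading term of `g` along a curve through `(0, Y₀)`. -/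
theorem isBigO_comp_sub_leading {g : ℝ × ℝ → ℝ}
    (hg : ContDiff ℝ (⊤ : ℕ∞) g) {m : ℕ} {c : ℝ → ℝ}
    (hlow : ∀ Y : ℝ, ∀ j < m, iteratedDeriv j (fun X => g (X, Y)) 0 = 0)
    (hchar : ∀ Y : ℝ, iteratedDeriv m (fun X => g (X, Y)) 0 = (m.factorial : ℝ) * c Y)
    {X Y : ℝ → ℝ} {a : ℝ} (hX : ContDiffAt ℝ 2 X 0) (hX0 : X 0 = 0) (hXa : HasDerivAt X a 0)
    (hY : DifferentiableAt ℝ Y 0) :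
    (fun t => g (X t, Y t) - c (Y 0) * (a * t) ^ m) =O[𝓝 0] (fun t => t ^ (m + 1)) := by
  have hXO : X =O[𝓝 0] (fun t => t) := by
    simpa [hX0] using hXa.differentiableAt.isBigO_sub
  have hYO : (fun t => Y t - Y 0) =O[𝓝 0] (fun t => t) := by
    simpa using hY.isBigO_sub
  have hXY : Tendsto (fun t => (X t, Y t)) (𝓝 0) (𝓝 (0, Y 0)) := by
    have := hXa.continuousAt.tendsto.prodMk_nhds hY.continuousAt.tendsto
    rwa [hX0] at this
  have hfst := ((isBigO_sub_leading_of_iteratedDeriv_eq_zero hg hlow hchar (Y 0)).comp_tendsto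
    hXY).trans (hXO.pow (m + 1))
  have hc : Differentiable ℝ c := by
    have hceq : c = fun y => ((m.factorial : ℝ))⁻¹ *
        iteratedDeriv m (fun X => g (X, y)) 0 := by
      funext y
      have := m.factorial_ne_zero
      rw [hchar]
      field_simp
    rw [hceq]
    exact (((contDiff_iteratedDeriv_fst hg m).comp
      (contDiff_const.prodMk contDiff_id : ContDiff ℝ (⊤ : ℕ∞) fun y : ℝ => ((0 : ℝ), y)))
        |>.differentiable (by simp)).const_mul _
  have hcO : (fun t => c (Y t) - c (Y 0)) =O[𝓝 0] (fun t => t) :=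
    ((hc (Y 0)).isBigO_sub.comp_tendsto hY.continuousAt.tendsto).trans hYO
  have hsnd : (fun t => (c (Y t) - c (Y 0)) * X t ^ m) =O[𝓝 0] (fun t => t ^ (m + 1)) := by
    simpa [pow_succ'] using hcO.mul (hXO.pow m)
  have hXa2 : (fun t => X t - a * t) =O[𝓝 0] (fun t => t ^ 2) := by
    simpa [hX0, hXa.deriv, mul_comm] using isBigO_sub_sub_mul_deriv hX
  have hpow : (fun t => X t ^ m - (a * t) ^ m) =O[𝓝 0] (fun t => t ^ (m + 1)) := by
    rcases m with _ | n
    · simp [isBigO_zero]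
    have hsum : (fun t => ∑ i ∈ Finset.range (n + 1), X t ^ i * (a * t) ^ (n + 1 - 1 - i))
        =O[𝓝 0] (fun t : ℝ => t ^ n) := by
      refine IsBigO.fun_sum fun i hi => ?_
      have hat : (fun t => a * t) =O[𝓝 0] (fun t : ℝ => t) := isBigO_const_mul_self a _ _
      refine ((hXO.pow i).mul (hat.pow (n + 1 - 1 - i))).congr_right fun t => ?_
      rw [← pow_add]
      congr 1
      have := Finset.mem_range.1 hi
      omega
    refine (hsum.mul hXa2).congr (fun t => ?_) (fun t => ?_)
    · exact (Commute.all (X t) (a * t)).geom_sum₂_mul (n + 1)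
    · rw [← pow_add]
  refine ((hfst.add hsnd).add (hpow.const_mul_left (c (Y 0)))).congr_left fun t => ?_
  simp only [Function.comp]
  ring

/-- Regularity at the origin of the ratio `η(ω)/ν(ω)` as a function of the lattice spacing. -/
theorem contDiffAt_eta_div_nu {β : ℝ} (hβ0 : 0 < β) (hβ1 : β < 1) (D v : ℝ) (ω : Fin 3) :
    ContDiffAt ℝ 2 (fun t => eta β (v * t / D) ω / nu β (v * t / D) ω) 0 := by
  have h1 : 1 - β ≠ 0 := by linarith
  fin_cases ω <;> simp only [eta, nu] <;> norm_num <;>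
    refine ContDiffAt.div (by fun_prop) (by fun_prop) ?_ <;> simp [hβ0.ne', h1]

theorem eta_div_nu_zero {β : ℝ} (hβ0 : 0 < β) (hβ1 : β < 1) (ω : Fin 3) :
    eta β 0 ω / nu β 0 ω = 1 := by
  have h1 : 1 - β ≠ 0 := by linarith
  fin_cases ω <;> simp [eta, nu, hβ0.ne', h1]

theorem hasDerivAt_eta_div_nu {β : ℝ} (hβ0 : 0 < β) (hβ1 : β < 1) (D v : ℝ) (ω : Fin 3) :
    HasDerivAt (fun t => eta β (v * t / D) ω / nu β (v * t / D) ω)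
      (-(v / D) * (1 - ((ω : ℕ) : ℝ))) 0 := by
  have h1 : 1 - β ≠ 0 := by linarith
  have hlin : HasDerivAt (fun t : ℝ => v * t / D / 2) (v / D / 2) 0 := by
    simpa using (((hasDerivAt_id (0 : ℝ)).const_mul v).div_const D).div_const 2
  have hm := (hlin.const_sub 1).const_mul (β / 2)
  have hp := (hlin.const_add 1).const_mul (β / 2)
  have hβ2 : β / 2 ≠ 0 := by positivity
  fin_cases ω
  · refine (hm.div hp (by simp [hβ0.ne'])).congr_deriv ?_
    simp
    field_simp
    ring
  · simpa [eta, nu, h1] using hasDerivAt_const (0 : ℝ) (1 : ℝ)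
  · refine (hp.div hm (by simp [hβ0.ne'])).congr_deriv ?_
    simp
    field_simp
    ring

/-- Leading term of `F_j(ω, u)`, which does not depend on `j`. -/
theorem isBigO_Floc_sub_leading {D v β r : ℝ} {ρ₀ : ℝ → ℝ} {f : ℝ → ℝ → ℝ} {m : ℕ}
    {Chat : ℝ → ℝ} (hβ0 : 0 < β) (hβ1 : β < 1)
    (hρ : ContDiff ℝ (⊤ : ℕ∞) ρ₀) (hf : ContDiff ℝ (⊤ : ℕ∞) (Function.uncurry f))
    (hlow : ∀ Y : ℝ, ∀ j < m, iteratedDeriv j (fun X => ftilde f X Y) 0 = 0)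
    (hchar : ∀ Y : ℝ, iteratedDeriv m (fun X => ftilde f X Y) 0 = (m.factorial : ℝ) * Chat Y)
    {K : ℕ} (j : ℤ) (ω u₀ : Fin 3) (u' : Fin K → Fin 3) :
    (fun t => Floc β (v * t / D) r t ρ₀ f j ω u₀ u' -
      Chat (ρ₀ r) *
        (-(v / D * ρ₀ r * (1 - ((ω : ℕ) : ℝ)) +
          (-(v / D) * ρ₀ r + deriv ρ₀ r) * (1 - ((u₀ : ℕ) : ℝ)))) ^ m * (t / 2) ^ m)
      =O[𝓝 0] (fun t => t ^ (m + 1)) := by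
  have hg : ContDiff ℝ (⊤ : ℕ∞) (fun p : ℝ × ℝ => ftilde f p.1 p.2) :=
    hf.comp ((contDiff_snd.add contDiff_fst).prodMk (contDiff_snd.sub contDiff_fst))
  set q : Fin 3 → ℝ → ℝ := fun σ t => eta β (v * t / D) σ / nu β (v * t / D) σ with hq
  set P : ℝ → ℝ := fun t => ∏ d, q (u' d) t with hP
  set s : ℝ := ∑ d, (1 - ((u' d : ℕ) : ℝ)) with hs
  have hqc : ∀ σ, ContDiffAt ℝ 2 (q σ) 0 := contDiffAt_eta_div_nu hβ0 hβ1 D v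
  have hq0 : ∀ σ, q σ 0 = 1 := fun σ => by simpa [hq] using eta_div_nu_zero hβ0 hβ1 σ
  have hPc : ContDiffAt ℝ 2 P 0 := contDiffAt_prod fun d _ => hqc (u' d)
  have hP0 : P 0 = 1 := by simp [hP, hq0]
  have hρ2 : ContDiff ℝ 2 ρ₀ := contDiff_infty.1 hρ 2
  set z : Fin 3 → ℝ → ℝ → ℝ := fun σ b t => q σ t * (P t * ρ₀ (r + (b + s) * t)) with hz
  have hzc : ∀ σ b, ContDiffAt ℝ 2 (z σ b) 0 := fun σ b =>
    (hqc σ).mul (hPc.mul (hρ2.comp (by fun_prop)).contDiffAt)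
  have hz0 : ∀ σ b, z σ b 0 = ρ₀ r := fun σ b => by simp [hz, hq0, hP0]
  have hzd : ∀ σ b, HasDerivAt (z σ b)
      (-(v / D) * (1 - ((σ : ℕ) : ℝ)) * ρ₀ r + (deriv P 0 * ρ₀ r + deriv ρ₀ r * (b + s))) 0 := by
    intro σ b
    have hlin : HasDerivAt (fun t : ℝ => r + (b + s) * t) (b + s) 0 := by
      simpa using ((hasDerivAt_id (0 : ℝ)).const_mul (b + s)).const_add r
    have hρd : HasDerivAt ρ₀ (deriv ρ₀ r) (r + (b + s) * 0) := by
      simpa using (hρ2.differentiable two_ne_zero r).hasDerivAt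
    refine ((hasDerivAt_eta_div_nu hβ0 hβ1 D v σ).mul
      ((hPc.differentiableAt two_ne_zero).hasDerivAt.mul (hρd.comp 0 hlin))).congr_deriv ?_
    simp [eta_div_nu_zero hβ0 hβ1, hP0]
  set x := z ω j with hx
  set y := z u₀ ((j + 1 - ((u₀ : ℕ) : ℤ) : ℤ) : ℝ) with hy
  have hmain := isBigO_comp_sub_leading (c := Chat) hg hlow hchar
    (X := fun t => (x t - y t) / 2) (Y := fun t => (x t + y t) / 2)
    (((hzc _ _).sub (hzc _ _)).div_const 2)
    (by simp [hx, hy, hz0]) (((hzd _ _).sub (hzd _ _)).div_const 2)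
    (((hzd _ _).add (hzd _ _)).div_const 2).differentiableAt
  refine hmain.congr_left fun t => ?_
  have hY0 : (x 0 + y 0) / 2 = ρ₀ r := by simp [hx, hy, hz0]
  have hF : Floc β (v * t / D) r t ρ₀ f j ω u₀ u' =
      ftilde f ((x t - y t) / 2) ((x t + y t) / 2) := by
    rw [ftilde, show (x t + y t) / 2 + (x t - y t) / 2 = x t by ring,
      show (x t + y t) / 2 - (x t - y t) / 2 = y t by ring]
    rfl
  rw [hY0, hF, mul_assoc (Chat _), ← mul_pow]
  push_cast
  congr 3
  ring

/-- Leading term of F and coincidence of the two transition terms: as Δr → 0⁺,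
F₀(ω,u) = Ĉ(ρ₀(r))·(−[X₁₀(1−ω) + X₀₁(1−u₀)])^m·(Δr/2)^m + O(Δr^(m+1)), with
X₁₀ = (v/D)ρ₀(r), X₀₁ = −(v/D)ρ₀(r) + ρ₀′(r), and moreover
F₀(ω,u) − F_{1−ω}(ω,u) = O(Δr^(m+1)); hence the leading-order term of
𝓕 = F₀ + ε(−1)^m F_{1−ω} carries the coefficient (1 + ε(−1)^m). -/
theorem leading_term_of_F
    (D v β r : ℝ) (k : ℕ) (ρ₀ : ℝ → ℝ) (f : ℝ → ℝ → ℝ)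
    (ε δ : ℝ) (m : ℕ) (Chat : ℝ → ℝ)
    (hD : 0 < D) (hβ0 : 0 < β) (hβ1 : β < 1) (hk : 1 ≤ k)
    (hρ : ContDiff ℝ (⊤ : ℕ∞) ρ₀) (hρpos : ∀ x, 0 < ρ₀ x)
    (hf : ContDiff ℝ (⊤ : ℕ∞) (Function.uncurry f))
    (hε : ε = 1 ∨ ε = -1) (hδ : δ = 1 ∨ δ = -1)
    (hsym : ∀ x y, f y x = (-1 : ℝ) ^ m * f x y)
    (hlow : ∀ Y : ℝ, ∀ j < m, iteratedDeriv j (fun X => ftilde f X Y) 0 = 0)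
    (hchar : ∀ Y : ℝ, iteratedDeriv m (fun X => ftilde f X Y) 0 = (m.factorial : ℝ) * Chat Y)
    (hCbdd : ∃ M : ℝ, ∀ y, |Chat y| ≤ M) (hCne : ∀ y, Chat y ≠ 0)
    :
    ∃ C > 0, ∃ Δ₀ > 0, ∀ Δr : ℝ, 0 < Δr → Δr < Δ₀ →
      ∀ (ω u₀ : Fin 3) (u' : Fin (k - 1) → Fin 3),
        |Floc β (v * Δr / D) r Δr ρ₀ f 0 ω u₀ u' -
            Chat (ρ₀ r) *
              (-(v / D * ρ₀ r * (1 - ((ω : ℕ) : ℝ)) +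
                  (-(v / D) * ρ₀ r + deriv ρ₀ r) * (1 - ((u₀ : ℕ) : ℝ)))) ^ m *
              (Δr / 2) ^ m| ≤ C * Δr ^ (m + 1) ∧
        |Floc β (v * Δr / D) r Δr ρ₀ f 0 ω u₀ u' -
            Floc β (v * Δr / D) r Δr ρ₀ f (1 - ((ω : ℕ) : ℤ)) ω u₀ u'|
          ≤ C * Δr ^ (m + 1) := by
  have hlead := fun (j : ℤ) (ω u₀ : Fin 3) (u' : Fin (k - 1) → Fin 3) =>
    isBigO_Floc_sub_leading (D := D) (v := v) (r := r) hβ0 hβ1 hρ hf hlow hchar j ω u₀ u'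
  have hfst := isBigO_pi.2 fun i : Fin 3 × Fin 3 × (Fin (k - 1) → Fin 3) =>
    hlead 0 i.1 i.2.1 i.2.2
  have hsnd := isBigO_pi.2 fun i : Fin 3 × Fin 3 × (Fin (k - 1) → Fin 3) =>
    (hlead 0 i.1 i.2.1 i.2.2).sub (hlead (1 - ((i.1 : ℕ) : ℤ)) i.1 i.2.1 i.2.2)
  obtain ⟨C₁, hC₁, h₁⟩ := hfst.exists_pos
  obtain ⟨C₂, hC₂, h₂⟩ := hsnd.exists_pos
  obtain ⟨Δ₀, hΔ₀, hball⟩ := Metric.eventually_nhds_iff.1 (h₁.bound.and h₂.bound)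
  refine ⟨C₁ + C₂, by positivity, Δ₀, hΔ₀, fun Δr hpos hlt ω u₀ u' => ?_⟩
  obtain ⟨hb₁, hb₂⟩ := hball (y := Δr) (by simpa [abs_of_pos hpos] using hlt)
  have hpow : 0 < Δr ^ (m + 1) := by positivity
  rw [Real.norm_of_nonneg hpow.le] at hb₁ hb₂
  have hi₁ := (norm_le_pi_norm _ (ω, u₀, u')).trans hb₁
  have hi₂ := (norm_le_pi_norm _ (ω, u₀, u')).trans hb₂
  simp only [Real.norm_eq_abs, sub_sub_sub_cancel_right] at hi₁ hi₂
  exact ⟨hi₁.trans (by gcongr; linarith), hi₂.trans (by gcongr; linarith)⟩
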